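/- Let π = ℤ be the infinite cyclic group, written multiplicatively with generator t. Let R be the additive subgroup of the integral group ring ℤ[π×π] generated by all BC elements (tᵐ, tⁿ) + (tⁿ, tᵐ), all SC elements (tᵐ, tⁿ) + (t⁻ᵐ, tⁿ⁻ᵐ), and all FR elements (tᵐ, 1) − (tᵐ, tᵐ), for all integers m, n. Then the quotient abelian group ℤ[π×π]/R is not finitely generated. -/

import Mathlib

/-- The infinite cyclic group, written multiplicatively. -/
abbrev InfCyc : Type := Multiplicative ℤ

/-- The generator `t` of the infinite cyclic group. -/
def tGen : InfCyc := Multiplicative.ofAdd 1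

/-- The basis element of the integral group ring `ℤ[π × π]`, `π = ⟨t⟩ ≅ ℤ`,
corresponding to the pair `(a, b)`. -/
noncomputable def pairElt (a b : InfCyc) : MonoidAlgebra ℤ (InfCyc × InfCyc) :=
  MonoidAlgebra.of ℤ (InfCyc × InfCyc) (a, b)

/-- The additive subgroup `R` of `ℤ[π × π]` generated by the BC elements
`(tᵐ,tⁿ) + (tⁿ,tᵐ)`, the SC elements `(tᵐ,tⁿ) + (t⁻ᵐ, tⁿ⁻ᵐ)` and the FR elements
`(tᵐ,1) − (tᵐ,tᵐ)`, for all integers `m`, `n`. -/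
noncomputable def relSubgroup : AddSubgroup (MonoidAlgebra ℤ (InfCyc × InfCyc)) :=
  AddSubgroup.closure
    ({x | ∃ m n : ℤ, x = pairElt (tGen ^ m) (tGen ^ n) + pairElt (tGen ^ n) (tGen ^ m)} ∪
     {x | ∃ m n : ℤ, x = pairElt (tGen ^ m) (tGen ^ n) + pairElt (tGen ^ (-m)) (tGen ^ (n - m))} ∪
     {x | ∃ m : ℤ, x = pairElt (tGen ^ m) 1 - pairElt (tGen ^ m) (tGen ^ m)})

/-- The class mod 2 of the multiset `{|m|, |n|, |n - m|}` of pairwise distances between the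
points `0`, `m`, `n` of the integer line. -/
noncomputable def distanceClass (m n : ℤ) : ℕ →₀ ZMod 2 :=
  Finsupp.single m.natAbs 1 + Finsupp.single n.natAbs 1 + Finsupp.single (n - m).natAbs 1

/-- The additive extension of `distanceClass` to `ℤ[π × π]`. -/
noncomputable def distanceHom : MonoidAlgebra ℤ (InfCyc × InfCyc) →+ (ℕ →₀ ZMod 2) :=
  (Finsupp.liftAddHom fun p : InfCyc × InfCyc =>
    (zmultiplesHom (ℕ →₀ ZMod 2)) (distanceClass p.1.toAdd p.2.toAdd)).comp
    (MonoidAlgebra.coeffAddEquiv (R := ℤ) (M := InfCyc × InfCyc)).toAddMonoidHom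

lemma distanceHom_pairElt (a b : InfCyc) :
    distanceHom (pairElt a b) = distanceClass a.toAdd b.toAdd := by
  simp [distanceHom, pairElt]

lemma toAdd_tGen_zpow (m : ℤ) : (tGen ^ m).toAdd = m := by
  simp [tGen]

lemma add_self_eq_zero_of_zmod_two (x : ℕ →₀ ZMod 2) : x + x = 0 := by
  ext i
  exact CharTwo.add_self_eq_zero (x i)

lemma distanceClass_comm (m n : ℤ) : distanceClass n m = distanceClass m n := by
  rw [distanceClass, distanceClass, ← Int.natAbs_neg (m - n), neg_sub]
  abel

lemma distanceClass_neg_sub (m n : ℤ) : distanceClass (-m) (n - m) = distanceClass m n := by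
  rw [distanceClass, distanceClass, Int.natAbs_neg, sub_neg_eq_add, sub_add_cancel]
  abel

lemma distanceClass_zero_right (m : ℤ) : distanceClass m 0 = distanceClass m m := by
  rw [distanceClass, distanceClass, zero_sub, Int.natAbs_neg, sub_self]
  abel

lemma distanceClass_two_mul (k : ℕ) :
    distanceClass k (2 * k) = Finsupp.single (2 * k) 1 := by
  have h₁ : ((2 : ℤ) * k).natAbs = 2 * k := by lia
  have h₂ : ((2 : ℤ) * k - k).natAbs = k := by lia
  rw [distanceClass, h₁, h₂, Int.natAbs_natCast, add_right_comm, add_self_eq_zero_of_zmod_two,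
    zero_add]

lemma relSubgroup_le_ker_distanceHom : relSubgroup ≤ distanceHom.ker := by
  rw [relSubgroup, AddSubgroup.closure_le]
  rintro x ((⟨m, n, rfl⟩ | ⟨m, n, rfl⟩) | ⟨m, rfl⟩) <;> rw [SetLike.mem_coe, AddMonoidHom.mem_ker]
  · rw [map_add, distanceHom_pairElt, distanceHom_pairElt, toAdd_tGen_zpow, toAdd_tGen_zpow,
      distanceClass_comm, add_self_eq_zero_of_zmod_two]
  · simp only [map_add, distanceHom_pairElt, toAdd_tGen_zpow, distanceClass_neg_sub,
      add_self_eq_zero_of_zmod_two]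
  · rw [map_sub, distanceHom_pairElt, distanceHom_pairElt, toAdd_tGen_zpow, toAdd_one,
      distanceClass_zero_right, sub_self]

lemma infinite_range_distanceHom : (Set.range distanceHom).Infinite := by
  refine (Set.infinite_range_of_injective
    (f := fun k : ℕ => (Finsupp.single (2 * k) 1 : ℕ →₀ ZMod 2)) fun k l h => ?_).mono ?_
  · have := Finsupp.single_left_injective (one_ne_zero (α := ZMod 2)) h
    lia
  · rintro _ ⟨k, rfl⟩
    refine ⟨pairElt (tGen ^ (k : ℤ)) (tGen ^ (2 * k : ℤ)), ?_⟩
    rw [distanceHom_pairElt, toAdd_tGen_zpow, toAdd_tGen_zpow, distanceClass_two_mul]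

/-- For `π` the infinite cyclic group generated by `t`, the quotient
abelian group `ℤ[π × π]/R` is not finitely generated. -/
theorem stmt_11 : ¬ AddGroup.FG (MonoidAlgebra ℤ (InfCyc × InfCyc) ⧸ relSubgroup) := by
  intro hfg
  let φ := QuotientAddGroup.lift relSubgroup distanceHom relSubgroup_le_ker_distanceHom
  have hrange : AddGroup.FG φ.range := AddGroup.fg_range φ
  have : Finite φ.range := by
    refine AddCommGroup.finite_of_fg_isAddTorsion _ fun x => ?_
    refine isOfFinAddOrder_iff_nsmul_eq_zero.mpr ⟨2, two_pos, Subtype.ext ?_⟩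
    rw [two_nsmul]
    exact add_self_eq_zero_of_zmod_two x
  refine infinite_range_distanceHom ((Set.toFinite (φ.range : Set (ℕ →₀ ZMod 2))).subset ?_)
  rintro _ ⟨x, rfl⟩
  exact ⟨QuotientAddGroup.mk x, rfl⟩
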